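/- arXiv:2504.15795 — 2 statements merged into one kernel-verified Lean document; each statement's English description precedes it below -/
import Mathlib

section
/- Let γ : [0,∞) → ℝ be defined by γ(s) = tanh(s·sin(log s)) for s > 0 and γ(0) = 0 (so γ is bounded and continuous). Set σ = 1/(1 + e^π). Then M(γ) = { θ·δ_{+1} + (1−θ)·δ_{−1} : θ ∈ [σ, 1−σ] }, where δ_{±1} are the Dirac probability measures at ±1. In particular M(γ) is a convex set of probability measures that is not a singleton, so γ is non-renormalisable. -/
open Filter Topology MeasureTheory

/-- The set `M(γ)` of subsequential Cesàro limit measures of a real curve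
`γ : [0,∞) → ℝ`. -/
def cesaroLimitsR (γ : ℝ → ℝ) : Set (ProbabilityMeasure ℝ) :=
  {μ | ∃ T : ℕ → ℝ, Tendsto T atTop atTop ∧
    ∀ F : ℝ → ℝ, Continuous F → (∃ C, ∀ x, |F x| ≤ C) →
      Tendsto (fun n => (1 / T n) * ∫ s in (0:ℝ)..(T n), F (γ s)) atTop
        (𝓝 (∫ x, F x ∂(μ : Measure ℝ)))}

/-- The curve `γ(s) = tanh(s·sin(log s))` for `s > 0`, `γ(0) = 0`. -/
noncomputable def gamTanh : ℝ → ℝ :=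
  fun s => if 0 < s then Real.tanh (s * Real.sin (Real.log s)) else 0

section OscillatingSign

open Real

theorem Real.measurable_sign : Measurable Real.sign := by
  unfold Real.sign
  exact Measurable.ite measurableSet_Iio measurable_const
    (Measurable.ite measurableSet_Ioi measurable_const measurable_const)

theorem Real.abs_sign_le_one (x : ℝ) : |Real.sign x| ≤ 1 := by
  rcases Real.sign_apply_eq x with h | h | h <;> simp [h]

theorem Real.tanh_eq_one_sub (x : ℝ) : tanh x = 1 - 2 / (exp (2 * x) + 1) := by
  have h1 : exp (2 * x) = exp x * exp x := by rw [← exp_add]; ring_nf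
  have hp := exp_pos x
  rw [tanh_eq, exp_neg, h1]
  field_simp
  ring

theorem Real.continuous_tanh : Continuous tanh := by
  rw [funext tanh_eq_one_sub]
  refine continuous_const.sub (continuous_const.div (by fun_prop) fun x => ?_)
  positivity

theorem Real.tendsto_tanh_atTop_one : Tendsto tanh atTop (𝓝 1) := by
  rw [funext tanh_eq_one_sub]
  have h : Tendsto (fun x : ℝ => exp (2 * x) + 1) atTop atTop :=
    tendsto_atTop_add_const_right _ _
      (tendsto_exp_atTop.comp (tendsto_id.const_mul_atTop two_pos))
  simpa using (tendsto_const_nhds (x := (1 : ℝ))).sub (h.const_div_atTop (2 : ℝ))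

theorem intervalIntegrable_of_measurable_of_bounded {f : ℝ → ℝ} {C : ℝ} (hf : Measurable f)
    (hC : ∀ x, |f x| ≤ C) (a b : ℝ) : IntervalIntegrable f volume a b :=
  (intervalIntegrable_const (c := C)).mono_fun' hf.aestronglyMeasurable
    (Eventually.of_forall hC)

theorem sin_log_exp_pi_mul (s : ℝ) : sin (log (exp π * s)) = -sin (log s) := by
  rcases eq_or_ne s 0 with rfl | hs
  · simp
  · rw [log_mul (exp_pos _).ne' hs, log_exp, add_comm, sin_add_pi]

theorem abs_sin_log_exp_pi_pow_mul (n : ℕ) (s : ℝ) :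
    |sin (log (exp π ^ n * s))| = |sin (log s)| := by
  induction n with
  | zero => simp
  | succ n ih => rw [pow_succ', mul_assoc, sin_log_exp_pi_mul, abs_neg, ih]

theorem one_lt_exp_pi : 1 < exp π := one_lt_exp_iff.2 pi_pos

theorem ae_sin_log_ne_zero : ∀ᵐ u : ℝ, 0 < u → sin (log u) ≠ 0 := by
  have hc : (Set.range fun n : ℤ => exp (n * π)).Countable := Set.countable_range _
  filter_upwards [hc.ae_notMem volume] with u hu h0 hs
  obtain ⟨n, hn⟩ := sin_eq_zero_iff.1 hs
  exact hu ⟨n, by simp only [hn, exp_log h0]⟩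

/-- Cesàro means along `s * sin (log s)` of a function vanishing at infinity tend to `0`. -/
theorem tendsto_cesaro_mul_sin_log {H : ℝ → ℝ} {C : ℝ} (hm : Measurable H)
    (hC : ∀ x, |H x| ≤ C) (hpos : ∀ x, 0 ≤ H x) (hH : Tendsto H atTop (𝓝 0)) :
    Tendsto (fun T => (1 / T) * ∫ s in (0:ℝ)..T, H |s * sin (log s)|) atTop (𝓝 0) := by
  have hE := one_lt_exp_pi
  set g : ℝ → ℝ := fun s => H |s * sin (log s)| with hg
  have hgm : Measurable g := hm.comp (by fun_prop)
  have hgi := intervalIntegrable_of_measurable_of_bounded hgm fun x => hC _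
  have hlim : Tendsto (fun n : ℕ => ∫ u in (0:ℝ)..1, g (exp π ^ n * u)) atTop (𝓝 0) := by
    have := intervalIntegral.tendsto_integral_filter_of_dominated_convergence
      (l := atTop) (F := fun (n : ℕ) u => g (exp π ^ n * u)) (f := fun _ => 0) (a := 0) (b := 1)
      (μ := volume) (fun _ => C)
      (Eventually.of_forall fun n => (hgm.comp (by fun_prop)).aestronglyMeasurable)
      (Eventually.of_forall fun n => Eventually.of_forall fun x _ => hC _)
      intervalIntegrable_const ?_
    · simpa using this
    · filter_upwards [ae_sin_log_ne_zero] with u hu hmem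
      rw [Set.uIoc_of_le zero_le_one] at hmem
      have hc : 0 < |u * sin (log u)| := abs_pos.2 (mul_ne_zero hmem.1.ne' (hu hmem.1))
      refine (hH.comp ((tendsto_pow_atTop_atTop_of_one_lt hE).atTop_mul_const hc)).congr fun n => ?_
      have hp : 0 < exp π ^ n := by positivity
      simp only [Function.comp, hg, abs_mul, abs_sin_log_exp_pi_pow_mul, abs_of_pos hp, mul_assoc]
  rw [Metric.tendsto_atTop] at hlim ⊢
  intro ε hε
  obtain ⟨N, hN⟩ := hlim (ε / exp π) (by positivity)
  refine ⟨exp π ^ N, fun T hT => ?_⟩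
  have hT1 : 1 ≤ T := (one_le_pow₀ hE.le).trans hT
  have hT0 : 0 < T := by linarith
  obtain ⟨n, hn1, hn2⟩ := exists_nat_pow_near hT1 hE
  have hNn : N ≤ n + 1 := by
    by_contra! h
    exact absurd (pow_le_pow_right₀ hE.le h.le) (by linarith)
  have hb := hN (n + 1) hNn
  have hscale := intervalIntegral.smul_integral_comp_mul_left (a := 0) (b := 1) g (exp π ^ (n + 1))
  have h0 : 0 ≤ ∫ s in (0:ℝ)..T, g s :=
    intervalIntegral.integral_nonneg hT0.le fun s _ => hpos _
  have hmono : ∫ s in (0:ℝ)..T, g s ≤ ∫ s in (0:ℝ)..exp π ^ (n + 1), g s :=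
    intervalIntegral.integral_mono_interval le_rfl hT0.le hn2.le
      (Eventually.of_forall fun s => hpos _) (hgi _ _)
  rw [mul_zero, mul_one, smul_eq_mul] at hscale
  rw [Real.dist_eq, sub_zero] at hb ⊢
  have hb' := (le_abs_self _).trans_lt hb
  rw [abs_of_nonneg (by positivity), one_div, inv_mul_lt_iff₀ hT0]
  calc _ ≤ exp π ^ (n + 1) * ∫ u in (0:ℝ)..1, g (exp π ^ (n + 1) * u) := by rwa [hscale]
    _ < exp π ^ (n + 1) * (ε / exp π) := by gcongr
    _ = exp π ^ n * ε := by rw [pow_succ]; field_simp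
    _ ≤ T * ε := by gcongr

/-- The mean over `[0, T]` of the sign of `sin (log s)`. -/
noncomputable def signMean (T : ℝ) : ℝ :=
  (1 / T) * ∫ s in (0:ℝ)..T, Real.sign (sin (log s))

theorem intervalIntegrable_sign_sin_log (a b : ℝ) :
    IntervalIntegrable (fun s => Real.sign (sin (log s))) volume a b :=
  intervalIntegrable_of_measurable_of_bounded
    (Real.measurable_sign.comp (by fun_prop)) (fun _ => Real.abs_sign_le_one _) a b

theorem signMean_exp_pi_mul (T : ℝ) : signMean (exp π * T) = -signMean T := by
  have h := intervalIntegral.smul_integral_comp_mul_left (a := 0) (b := T)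
    (fun s => Real.sign (sin (log s))) (exp π)
  simp only [sin_log_exp_pi_mul, Real.sign_neg, intervalIntegral.integral_neg, mul_zero,
    smul_eq_mul] at h
  rw [signMean, signMean, ← h]
  have := exp_pos π
  rcases eq_or_ne T 0 with rfl | hT
  · simp
  · field_simp

theorem abs_signMean_exp_pi_pow_mul (n : ℕ) (T : ℝ) :
    |signMean (exp π ^ n * T)| = |signMean T| := by
  induction n with
  | zero => simp
  | succ n ih => rw [pow_succ', mul_assoc, signMean_exp_pi_mul, abs_neg, ih]

theorem signMean_exp_pi_sq_pow_mul (n : ℕ) (T : ℝ) :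
    signMean ((exp π ^ 2) ^ n * T) = signMean T := by
  induction n with
  | zero => simp
  | succ n ih =>
    rw [pow_succ', pow_two, mul_assoc, mul_assoc, signMean_exp_pi_mul, signMean_exp_pi_mul, neg_neg,
      ← pow_two, ih]

theorem signMean_eq_on_Icc {T : ℝ} (hT : T ∈ Set.Icc 1 (exp π)) :
    signMean T = 1 - 2 * (exp π / (1 + exp π)) / T := by
  have hE := exp_pos π
  have hadd : ∀ T ∈ Set.Icc 1 (exp π), T * signMean T = signMean 1 + (T - 1) := by
    intro T hT
    have h1 : ∫ s in (1:ℝ)..T, Real.sign (sin (log s)) = T - 1 := by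
      rw [intervalIntegral.integral_congr_Ioo_of_le (g := fun _ => (1 : ℝ)) hT.1]
      · simp
      · intro s hs
        refine Real.sign_of_pos (sin_pos_of_pos_of_lt_pi (log_pos hs.1) ?_)
        rw [log_lt_iff_lt_exp (by linarith [hs.1])]
        exact hs.2.trans_le hT.2
    have h2 := intervalIntegral.integral_add_adjacent_intervals
      (intervalIntegrable_sign_sin_log 0 1) (intervalIntegrable_sign_sin_log 1 T)
    have hT0 : T ≠ 0 := by linarith [hT.1]
    rw [signMean, signMean, ← h2, h1]
    field_simp
  have hper := hadd (exp π) ⟨one_lt_exp_pi.le, le_rfl⟩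
  have hneg := signMean_exp_pi_mul 1
  rw [mul_one] at hneg
  rw [hneg] at hper
  have h1 : signMean 1 = (1 - exp π) / (1 + exp π) := by
    field_simp
    linarith
  have hT0 : T ≠ 0 := by linarith [hT.1]
  have h := hadd T hT
  rw [h1] at h
  field_simp at h ⊢
  linarith

theorem abs_signMean_le {T : ℝ} (hT : 1 ≤ T) : |signMean T| ≤ 1 - 2 * (1 / (1 + exp π)) := by
  have hE := one_lt_exp_pi
  obtain ⟨n, hn1, hn2⟩ := exists_nat_pow_near hT hE
  have hp : 0 < exp π ^ n := by positivity
  have hmem : T / exp π ^ n ∈ Set.Icc 1 (exp π) :=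
    ⟨(one_le_div hp).2 hn1, (div_le_iff₀ hp).2 (by rw [← pow_succ']; exact hn2.le)⟩
  rw [show T = exp π ^ n * (T / exp π ^ n) by field_simp, abs_signMean_exp_pi_pow_mul,
    signMean_eq_on_Icc hmem]
  generalize T / exp π ^ n = S at hmem
  have hS : 0 < S := by linarith [hmem.1]
  have key1 : 2 * (exp π / (1 + exp π)) / S ≤ 2 * (exp π / (1 + exp π)) :=
    div_le_self (by positivity) hmem.1
  have key2 : 2 * (1 / (1 + exp π)) ≤ 2 * (exp π / (1 + exp π)) / S := by
    rw [le_div_iff₀ hS]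
    have : 1 / (1 + exp π) * S ≤ exp π / (1 + exp π) := by
      rw [one_div_mul_eq_div]
      gcongr
      exact hmem.2
    linarith
  have hsum : exp π / (1 + exp π) + 1 / (1 + exp π) = 1 := by field_simp; ring
  rw [abs_le]
  constructor <;> linarith

theorem exists_signMean_eq {c : ℝ} (hc : |c| ≤ 1 - 2 * (1 / (1 + exp π))) :
    ∃ T, 0 < T ∧ signMean T = c := by
  have hE := one_lt_exp_pi
  have hsum : exp π / (1 + exp π) + 1 / (1 + exp π) = 1 := by field_simp; ring
  obtain ⟨h1, h2⟩ := abs_le.1 hc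
  have hs : 0 < 1 / (1 + exp π) := by positivity
  have hc0 : 0 < 1 - c := by linarith
  have hmem : 2 * (exp π / (1 + exp π)) / (1 - c) ∈ Set.Icc 1 (exp π) := by
    refine ⟨(one_le_div hc0).2 (by linarith), (div_le_iff₀ hc0).2 ?_⟩
    rw [show 2 * (exp π / (1 + exp π)) = exp π * (2 * (1 / (1 + exp π))) by ring]
    gcongr
    linarith
  refine ⟨_, one_pos.trans_le hmem.1, ?_⟩
  rw [signMean_eq_on_Icc hmem, div_div_cancel₀ (by positivity)]
  ring

theorem tendsto_cesaro_gamTanh_sub {F : ℝ → ℝ} (hF : Continuous F) (hb : ∃ C, ∀ x, |F x| ≤ C) :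
    Tendsto (fun T => (1 / T) * (∫ s in (0:ℝ)..T, F (gamTanh s)) -
      ((F 1 + F (-1)) / 2 + signMean T * ((F 1 - F (-1)) / 2))) atTop (𝓝 0) := by
  obtain ⟨C, hC⟩ := hb
  set A := (F 1 + F (-1)) / 2 with hA
  set B := (F 1 - F (-1)) / 2 with hB
  set h : ℝ → ℝ := fun x => F (tanh x) - A - Real.sign x * B with hh
  have hhm : Measurable h :=
    ((hF.comp continuous_tanh).measurable.sub_const _).sub (Real.measurable_sign.mul_const _)
  have hhb : ∀ x, |h x| ≤ C + |A| + |B| := fun x => by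
    have h1 := abs_sub (F (tanh x) - A) (Real.sign x * B)
    have h2 := abs_sub (F (tanh x)) A
    have h3 : |Real.sign x * B| ≤ |B| := by
      rw [abs_mul]
      exact mul_le_of_le_one_left (abs_nonneg _) (Real.abs_sign_le_one x)
    have h4 := hC (tanh x)
    simp only [hh]
    linarith
  have hpos : Tendsto h atTop (𝓝 0) := by
    have h1 : Tendsto (fun x => F (tanh x) - A - B) atTop (𝓝 (F 1 - A - B)) :=
      (((hF.tendsto 1).comp tendsto_tanh_atTop_one).sub_const A).sub_const B
    rw [show F 1 - A - B = 0 by rw [hA, hB]; ring] at h1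
    refine h1.congr' ?_
    filter_upwards [eventually_gt_atTop 0] with x hx
    simp [hh, Real.sign_of_pos hx]
  have hneg : Tendsto (fun x => h (-x)) atTop (𝓝 0) := by
    have h1 : Tendsto (fun x => F (-tanh x) - A + B) atTop (𝓝 (F (-1) - A + B)) :=
      (((hF.tendsto (-1)).comp tendsto_tanh_atTop_one.neg).sub_const A).add_const B
    rw [show F (-1) - A + B = 0 by rw [hA, hB]; ring] at h1
    refine h1.congr' ?_
    filter_upwards [eventually_gt_atTop 0] with x hx
    simp [hh, Real.sign_neg, Real.sign_of_pos hx, Real.tanh_neg]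
  have hle : ∀ x, |h x| ≤ |h (|x|)| + |h (-|x|)| := fun x => by
    rcases abs_choice x with hx | hx
    · rw [hx]; linarith [abs_nonneg (h (-x))]
    · rw [hx, neg_neg]; linarith [abs_nonneg (h (-x))]
  have hmain := tendsto_cesaro_mul_sin_log (H := fun x => |h x| + |h (-x)|)
    (C := (C + |A| + |B|) + (C + |A| + |B|)) (by fun_prop)
    (fun x => by
      rw [abs_of_nonneg (by positivity)]
      exact add_le_add (hhb x) (hhb (-x)))
    (fun x => by positivity) (by simpa using hpos.abs.add hneg.abs)
  refine squeeze_zero_norm' ?_ hmain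
  filter_upwards [eventually_gt_atTop 0] with T hT
  have hi : IntervalIntegrable (fun s => h (s * sin (log s))) volume 0 T :=
    intervalIntegrable_of_measurable_of_bounded (hhm.comp (by fun_prop)) (fun _ => hhb _) 0 T
  have hFi : ∫ s in (0:ℝ)..T, F (gamTanh s) = (∫ s in (0:ℝ)..T, h (s * sin (log s))) +
      ((T * A) + (∫ s in (0:ℝ)..T, Real.sign (sin (log s))) * B) := by
    have hconst : T * A = ∫ s in (0:ℝ)..T, A := by simp
    rw [hconst, ← intervalIntegral.integral_mul_const,
      ← intervalIntegral.integral_add intervalIntegrable_const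
        ((intervalIntegrable_sign_sin_log 0 T).mul_const B),
      ← intervalIntegral.integral_add hi (intervalIntegrable_const.add
        ((intervalIntegrable_sign_sin_log 0 T).mul_const B))]
    refine intervalIntegral.integral_congr_Ioo_of_le hT.le fun s hs => ?_
    have hsign : Real.sign (s * sin (log s)) = Real.sign (sin (log s)) := by
      rcases lt_trichotomy (sin (log s)) 0 with h0 | h0 | h0
      · rw [Real.sign_of_neg h0, Real.sign_of_neg (mul_neg_of_pos_of_neg hs.1 h0)]
      · rw [h0, mul_zero]
      · rw [Real.sign_of_pos h0, Real.sign_of_pos (mul_pos hs.1 h0)]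
    simp only [gamTanh, if_pos hs.1, hh, hsign]
    ring
  have heq : (1 / T) * (∫ s in (0:ℝ)..T, F (gamTanh s)) - (A + signMean T * B) =
      (1 / T) * ∫ s in (0:ℝ)..T, h (s * sin (log s)) := by
    rw [hFi, signMean]
    field_simp
    ring
  rw [heq, norm_mul, Real.norm_eq_abs, abs_of_pos (by positivity)]
  gcongr
  refine intervalIntegral.norm_integral_le_of_norm_le hT.le
    (Eventually.of_forall fun s _ => hle _) ?_
  refine intervalIntegrable_of_measurable_of_bounded
    (C := (C + |A| + |B|) + (C + |A| + |B|)) ?_ (fun x => ?_) 0 T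
  · exact ((hhm.comp (by fun_prop)).norm).add ((hhm.comp (by fun_prop)).norm)
  · rw [abs_of_nonneg (by positivity)]
    exact add_le_add (hhb _) (hhb _)

end OscillatingSign

section TwoPointMeasures

/-- The measure with mass `θ` at `1` and `1 - θ` at `-1`. -/
noncomputable def twoPointMeasure (θ : ℝ) : Measure ℝ :=
  ENNReal.ofReal θ • Measure.dirac (1 : ℝ) + ENNReal.ofReal (1 - θ) • Measure.dirac (-1 : ℝ)

theorem isProbabilityMeasure_twoPointMeasure {θ : ℝ} (h : θ ∈ Set.Icc (0:ℝ) 1) :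
    IsProbabilityMeasure (twoPointMeasure θ) := by
  constructor
  simp [twoPointMeasure, ← ENNReal.ofReal_add h.1 (sub_nonneg.2 h.2)]

instance (θ : ℝ) : IsFiniteMeasure (twoPointMeasure θ) := by
  constructor
  simp [twoPointMeasure]

theorem integral_twoPointMeasure {θ : ℝ} (h : θ ∈ Set.Icc (0:ℝ) 1) (F : ℝ → ℝ) :
    ∫ x, F x ∂twoPointMeasure θ = θ * F 1 + (1 - θ) * F (-1) := by
  have hi : ∀ a : ℝ, Integrable F (Measure.dirac a) := fun a => integrable_dirac (by simp)
  rw [twoPointMeasure, integral_add_measure ((hi _).smul_measure ENNReal.ofReal_ne_top)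
    ((hi _).smul_measure ENNReal.ofReal_ne_top)]
  simp [h.1, h.2]

theorem twoPointMeasure_convexCombination {t θ₁ θ₂ : ℝ} (ht : t ∈ Set.Icc (0:ℝ) 1)
    (h₁ : θ₁ ∈ Set.Icc (0:ℝ) 1) (h₂ : θ₂ ∈ Set.Icc (0:ℝ) 1) :
    twoPointMeasure (t * θ₁ + (1 - t) * θ₂) =
      ENNReal.ofReal t • twoPointMeasure θ₁ + ENNReal.ofReal (1 - t) • twoPointMeasure θ₂ := by
  have ht' := sub_nonneg.2 ht.2
  have h₁' := sub_nonneg.2 h₁.2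
  have h₂' := sub_nonneg.2 h₂.2
  have e : 1 - (t * θ₁ + (1 - t) * θ₂) = t * (1 - θ₁) + (1 - t) * (1 - θ₂) := by ring
  rw [twoPointMeasure, e, ENNReal.ofReal_add (mul_nonneg ht.1 h₁.1) (mul_nonneg ht' h₂.1),
    ENNReal.ofReal_add (mul_nonneg ht.1 h₁') (mul_nonneg ht' h₂'),
    ENNReal.ofReal_mul ht.1, ENNReal.ofReal_mul ht', ENNReal.ofReal_mul ht.1,
    ENNReal.ofReal_mul ht', twoPointMeasure, twoPointMeasure]
  simp only [add_smul, smul_add, mul_smul]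
  abel

end TwoPointMeasures

theorem sigma_mem_Ioo :
    1 / (1 + Real.exp Real.pi) ∈ Set.Ioo (0:ℝ) (1 / 2) := by
  have := one_lt_exp_pi
  exact ⟨by positivity, one_div_lt_one_div_of_lt two_pos (by linarith)⟩

theorem mem_cesaroLimitsR_gamTanh_iff (μ : ProbabilityMeasure ℝ) :
    μ ∈ cesaroLimitsR gamTanh ↔
      ∃ θ ∈ Set.Icc (1 / (1 + Real.exp Real.pi)) (1 - 1 / (1 + Real.exp Real.pi)),
        (μ : Measure ℝ) = twoPointMeasure θ := by
  obtain ⟨hσ0, hσ1⟩ := sigma_mem_Ioo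
  have hE := one_lt_exp_pi
  constructor
  · rintro ⟨T, hT, h⟩
    have hlim : ∀ F : ℝ → ℝ, Continuous F → (∃ C, ∀ x, |F x| ≤ C) →
        Tendsto (fun n => (F 1 + F (-1)) / 2 + signMean (T n) * ((F 1 - F (-1)) / 2)) atTop
          (𝓝 (∫ x, F x ∂(μ : Measure ℝ))) := fun F hF hb => by
      simpa using (h F hF hb).sub ((tendsto_cesaro_gamTanh_sub hF hb).comp hT)
    set c := ∫ x, max (-1) (min x 1) ∂(μ : Measure ℝ) with hc
    have hmean : Tendsto (fun n => signMean (T n)) atTop (𝓝 c) := by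
      have := hlim (fun x => max (-1) (min x 1)) (by fun_prop)
        ⟨1, fun x => abs_le.2 ⟨le_max_left _ _, max_le (by norm_num) (min_le_right _ _)⟩⟩
      norm_num at this
      exact this
    have hcb : |c| ≤ 1 - 2 * (1 / (1 + Real.exp Real.pi)) := by
      refine le_of_tendsto hmean.abs ?_
      filter_upwards [hT.eventually_ge_atTop 1] with n hn using abs_signMean_le hn
    obtain ⟨hc1, hc2⟩ := abs_le.1 hcb
    refine ⟨(1 + c) / 2, ⟨by linarith, by linarith⟩, ?_⟩
    refine ext_of_forall_integral_eq_of_IsFiniteMeasure fun f => ?_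
    have hf := hlim f f.continuous ⟨‖f‖, fun x => f.norm_coe_le_norm x⟩
    rw [integral_twoPointMeasure ⟨by linarith, by linarith⟩,
      tendsto_nhds_unique hf ((hmean.mul_const _).const_add _)]
    ring
  · rintro ⟨θ, hθ, hμ⟩
    obtain ⟨T, hT, hTc⟩ := exists_signMean_eq (c := 2 * θ - 1)
      (abs_le.2 ⟨by linarith [hθ.1], by linarith [hθ.2]⟩)
    have hlim : Tendsto (fun n : ℕ => (Real.exp Real.pi ^ 2) ^ n * T) atTop atTop :=
      (tendsto_pow_atTop_atTop_of_one_lt (one_lt_pow₀ hE two_ne_zero)).atTop_mul_const hT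
    refine ⟨_, hlim, fun F hF hb => ?_⟩
    have h := ((tendsto_cesaro_gamTanh_sub hF hb).comp hlim).add_const
      ((F 1 + F (-1)) / 2 + (2 * θ - 1) * ((F 1 - F (-1)) / 2))
    rw [hμ, integral_twoPointMeasure ⟨by linarith [hθ.1], by linarith [hθ.2]⟩]
    convert h using 2
    · simp [Function.comp, signMean_exp_pi_sq_pow_mul, hTc]
    · ring

/-- For `γ(s) = tanh(s sin log s)` and `σ = 1/(1+e^π)`, the set `M(γ)` equals
`{θ δ₁ + (1−θ) δ₋₁ : θ ∈ [σ, 1−σ]}`; moreover `M(γ)` is convex and is not a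
singleton, so `γ` is non-renormalisable. -/
theorem stmt_5 :
    (cesaroLimitsR gamTanh =
      {μ : ProbabilityMeasure ℝ |
        ∃ θ ∈ Set.Icc (1 / (1 + Real.exp Real.pi)) (1 - 1 / (1 + Real.exp Real.pi)),
          (μ : Measure ℝ)
            = ENNReal.ofReal θ • Measure.dirac (1 : ℝ)
              + ENNReal.ofReal (1 - θ) • Measure.dirac (-1 : ℝ)}) ∧
    (∀ μ₁ ∈ cesaroLimitsR gamTanh, ∀ μ₂ ∈ cesaroLimitsR gamTanh,
      ∀ t ∈ Set.Icc (0:ℝ) 1, ∃ μ ∈ cesaroLimitsR gamTanh,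
        (μ : Measure ℝ)
          = ENNReal.ofReal t • (μ₁ : Measure ℝ) + ENNReal.ofReal (1 - t) • (μ₂ : Measure ℝ)) ∧
    ¬ ∃ μ : ProbabilityMeasure ℝ, cesaroLimitsR gamTanh = {μ} := by
  have hσ := sigma_mem_Ioo
  have hunit : ∀ θ ∈ Set.Icc (1 / (1 + Real.exp Real.pi)) (1 - 1 / (1 + Real.exp Real.pi)),
      θ ∈ Set.Icc (0:ℝ) 1 := fun θ hθ => ⟨hσ.1.le.trans hθ.1, by linarith [hθ.2, hσ.1]⟩
  have hmem : ∀ θ (hθ : θ ∈ Set.Icc (1 / (1 + Real.exp Real.pi)) (1 - 1 / (1 + Real.exp Real.pi))),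
      (⟨twoPointMeasure θ, isProbabilityMeasure_twoPointMeasure (hunit θ hθ)⟩ :
        ProbabilityMeasure ℝ) ∈ cesaroLimitsR gamTanh := fun θ hθ =>
    (mem_cesaroLimitsR_gamTanh_iff _).2 ⟨θ, hθ, rfl⟩
  refine ⟨Set.ext mem_cesaroLimitsR_gamTanh_iff, ?_, ?_⟩
  · intro μ₁ hμ₁ μ₂ hμ₂ t ht
    obtain ⟨θ₁, h₁, e₁⟩ := (mem_cesaroLimitsR_gamTanh_iff _).1 hμ₁
    obtain ⟨θ₂, h₂, e₂⟩ := (mem_cesaroLimitsR_gamTanh_iff _).1 hμ₂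
    refine ⟨_, hmem (t * θ₁ + (1 - t) * θ₂)
      (convex_Icc _ _ h₁ h₂ ht.1 (sub_nonneg.2 ht.2) (by ring)), ?_⟩
    rw [e₁, e₂]
    exact twoPointMeasure_convexCombination ht (hunit _ h₁) (hunit _ h₂)
  · rintro ⟨μ, hμ⟩
    have hl := Set.left_mem_Icc.2 (show 1 / (1 + Real.exp Real.pi) ≤
      1 - 1 / (1 + Real.exp Real.pi) by linarith [hσ.2])
    have hr := Set.right_mem_Icc.2 (show 1 / (1 + Real.exp Real.pi) ≤
      1 - 1 / (1 + Real.exp Real.pi) by linarith [hσ.2])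
    have e₁ := hmem _ hl
    have e₂ := hmem _ hr
    rw [hμ] at e₁ e₂
    have e := congrArg (fun ν : ProbabilityMeasure ℝ => ∫ x, x ∂(ν : Measure ℝ))
      ((Set.mem_singleton_iff.1 e₁).trans (Set.mem_singleton_iff.1 e₂).symm)
    simp only [ProbabilityMeasure.coe_mk] at e
    rw [integral_twoPointMeasure (hunit _ hl), integral_twoPointMeasure (hunit _ hr)] at e
    linarith [hσ.2]
end

section
/- Let d ≥ 1 and let K ⊆ ℝ^d be a nonempty compact connected set. Then there exists a single bounded continuous curve γ_un : [0,∞) → ℝ^d with dist(γ_un(s), K) → 0 as s → ∞ such that M(γ_un) equals the whole set P(K) of Borel probability measures giving full mass to K. In particular γ_un is non-renormalisable and realises all statistical behaviours supported in K along subsequences. -/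
open Filter Topology MeasureTheory

/-- The set `M(γ)` of subsequential Cesàro limit measures of a curve
`γ : [0,∞) → ℝ^d`. -/
def cesaroLimits {d : ℕ} (γ : ℝ → EuclideanSpace ℝ (Fin d)) :
    Set (ProbabilityMeasure (EuclideanSpace ℝ (Fin d))) :=
  {μ | ∃ T : ℕ → ℝ, Tendsto T atTop atTop ∧
    ∀ F : EuclideanSpace ℝ (Fin d) → ℝ, Continuous F → (∃ C, ∀ x, |F x| ≤ C) →
      Tendsto (fun n => (1 / T n) * ∫ s in (0:ℝ)..(T n), F (γ s)) atTop
        (𝓝 (∫ x, F x ∂(μ : Measure (EuclideanSpace ℝ (Fin d)))))}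

/-- The mean of `f` over the first `N` terms of the sequence `y`. -/
noncomputable def birkhoffMean {X : Type*} (y : ℕ → X) (f : X → ℝ) (N : ℕ) : ℝ :=
  (N : ℝ)⁻¹ * ∑ i ∈ Finset.range N, f (y i)

theorem dist_birkhoffMean_le {X : Type*} (y : ℕ → X) {f g : X → ℝ} {ε : ℝ} (hε : 0 ≤ ε)
    (h : ∀ x, dist (f x) (g x) ≤ ε) (N : ℕ) :
    dist (birkhoffMean y f N) (birkhoffMean y g N) ≤ ε := by
  rcases N.eq_zero_or_pos with rfl | hN
  · simpa [birkhoffMean] using hε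
  have hN' : (0 : ℝ) < N := by exact_mod_cast hN
  rw [birkhoffMean, birkhoffMean, Real.dist_eq, ← mul_sub, abs_mul, abs_inv, Nat.abs_cast,
    ← Real.dist_eq, inv_mul_le_iff₀ hN']
  calc _ ≤ ∑ i ∈ Finset.range N, dist (f (y i)) (g (y i)) := dist_sum_sum_le _ _ _
    _ ≤ ∑ i ∈ Finset.range N, ε := Finset.sum_le_sum fun i _ => h _
    _ = N * ε := by simp

/-- Changing finitely many terms of a sequence does not change the limit of its means. -/
theorem tendsto_birkhoffMean_congr {X : Type*} {y z : ℕ → X} (h : y =ᶠ[atTop] z) {f : X → ℝ}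
    {l : ℝ} (hz : Tendsto (birkhoffMean z f) atTop (𝓝 l)) :
    Tendsto (birkhoffMean y f) atTop (𝓝 l) := by
  have h0 : Tendsto (fun i => f (y i) - f (z i)) atTop (𝓝 0) :=
    tendsto_const_nhds.congr' (h.mono fun i hi => by simp [hi])
  have h1 := h0.cesaro.add hz
  rw [zero_add] at h1
  exact h1.congr fun N => by simp [birkhoffMean, mul_sub]

/-- Every probability measure is generic for some sequence, along countably many observables. -/
theorem exists_tendsto_birkhoffMean {X : Type*} [MeasurableSpace X] (ν : Measure X)
    [IsProbabilityMeasure ν] (f : ℕ → X → ℝ) (hm : ∀ j, Measurable (f j))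
    (hf : ∀ j, Integrable (f j) ν) :
    ∃ z : ℕ → X, ∀ j, Tendsto (birkhoffMean z (f j)) atTop (𝓝 (∫ x, f j x ∂ν)) := by
  have key : ∀ j, ∀ᵐ z ∂(Measure.infinitePi fun _ : ℕ => ν),
      Tendsto (birkhoffMean z (f j)) atTop (𝓝 (∫ x, f j x ∂ν)) := by
    intro j
    have hp : ∀ i, MeasurePreserving (fun z : ℕ → X => z i) (Measure.infinitePi fun _ => ν) ν :=
      fun i => measurePreserving_eval_infinitePi (fun _ => ν) i
    have hind := ProbabilityTheory.iIndepFun_infinitePi (P := fun _ : ℕ => ν)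
      (X := fun _ => f j) fun _ => hm j
    have h := ProbabilityTheory.strong_law_ae_real (μ := Measure.infinitePi fun _ : ℕ => ν)
      (fun i z => f j (z i)) ((hp 0).integrable_comp_of_integrable (hf j))
      (fun a b hab => hind.indepFun hab)
      (fun i => ⟨((hm j).comp (hp i).measurable).aemeasurable,
        ((hm j).comp (hp 0).measurable).aemeasurable, by
          have e := fun i => Measure.map_map (hm j) (hp i).measurable
            (μ := Measure.infinitePi fun _ : ℕ => ν)
          simp only [(hp _).map_eq] at e
          exact (e i).symm.trans (e 0)⟩)
    have hint : ∫ z, f j (z 0) ∂(Measure.infinitePi fun _ : ℕ => ν) = ∫ x, f j x ∂ν := by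
      conv_rhs => rw [← (hp 0).map_eq]
      exact (integral_map (hp 0).measurable.aemeasurable (hm j).aestronglyMeasurable).symm
    rw [hint] at h
    filter_upwards [h] with z hz
    refine hz.congr fun n => ?_
    rw [birkhoffMean, div_eq_inv_mul]
  exact (ae_all_iff.2 key).exists

theorem tendsto_birkhoffMean_of_denseRange {X : Type*} [TopologicalSpace X] [CompactSpace X]
    [MeasurableSpace X] [BorelSpace X] (ν : Measure X) [IsProbabilityMeasure ν]
    {f : ℕ → C(X, ℝ)} (hf : DenseRange f) {y : ℕ → X} {N : ℕ → ℕ}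
    (h : ∀ j, Tendsto (fun k => birkhoffMean y (f j) (N k)) atTop (𝓝 (∫ x, f j x ∂ν)))
    (g : C(X, ℝ)) :
    Tendsto (fun k => birkhoffMean y g (N k)) atTop (𝓝 (∫ x, g x ∂ν)) := by
  rw [Metric.tendsto_nhds]
  intro ε hε
  obtain ⟨j, hj⟩ := hf.exists_dist_lt g (show 0 < ε / 3 by positivity)
  have hint : ∀ u : C(X, ℝ), Integrable u ν := fun u =>
    u.continuous.integrable_of_hasCompactSupport (HasCompactSupport.of_compactSpace u)
  have hpt : ∀ x, dist (g x) (f j x) ≤ ε / 3 := fun x =>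
    (ContinuousMap.dist_apply_le_dist x).trans hj.le
  have h2 : dist (∫ x, f j x ∂ν) (∫ x, g x ∂ν) ≤ ε / 3 := by
    rw [dist_comm, dist_eq_norm, ← integral_sub (hint _) (hint _)]
    simpa using norm_integral_le_of_norm_le_const (μ := ν) (f := fun x => g x - f j x)
      (.of_forall fun x => (dist_eq_norm (g x) (f j x)).symm.trans_le (hpt x))
  filter_upwards [Metric.tendsto_nhds.1 (h j) (ε / 3) (by positivity)] with k hk
  have h1 := dist_birkhoffMean_le y (by positivity) hpt (N k)
  have := dist_triangle4 (birkhoffMean y g (N k)) (birkhoffMean y (f j) (N k))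
    (∫ x, f j x ∂ν) (∫ x, g x ∂ν)
  linarith

/-- In a compact metric space there is a sequence whose empirical measures accumulate at every
probability measure. -/
theorem exists_universal_seq (X : Type*) [MetricSpace X] [CompactSpace X] [Nonempty X]
    [MeasurableSpace X] [BorelSpace X] :
    ∃ y : ℕ → X, ∀ ν : Measure X, IsProbabilityMeasure ν → ∃ N : ℕ → ℕ, StrictMono N ∧
      ∀ g : C(X, ℝ), Tendsto (fun k => birkhoffMean y g (N k)) atTop (𝓝 (∫ x, g x ∂ν)) := by
  obtain ⟨f, hf⟩ := TopologicalSpace.exists_dense_seq C(X, ℝ)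
  let e : (ℕ → X) → ℕ → ℕ → ℝ := fun y N j => birkhoffMean y (f j) N
  have he : ∀ N, Continuous fun y => e y N := fun N => by
    unfold e birkhoffMean
    fun_prop
  let Φ : Measure X → ℕ → ℝ := fun ν j => ∫ x, f j x ∂ν
  let 𝓑 : Set (Set (ℕ → ℝ)) := {B ∈ TopologicalSpace.countableBasis (ℕ → ℝ) |
    ∃ ν : Measure X, IsProbabilityMeasure ν ∧ Φ ν ∈ B}
  have h𝓑 : 𝓑.Countable := (TopologicalSpace.countable_countableBasis _).mono fun B hB => hB.1
  have : Countable 𝓑 := h𝓑.to_subtype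
  let U : 𝓑 × ℕ → Set (ℕ → X) := fun p => ⋃ N ≥ p.2, (fun y => e y N) ⁻¹' p.1.1
  have hB : ∀ B : 𝓑, IsOpen B.1 := fun B => TopologicalSpace.isOpen_of_mem_countableBasis B.2.1
  have hUo : ∀ p, IsOpen (U p) := fun p =>
    isOpen_biUnion fun N _ => (hB p.1).preimage (he N)
  have hUd : ∀ p, Dense (U p) := by
    rintro ⟨B, k⟩
    obtain ⟨-, ν, hν, hνB⟩ := B.2
    obtain ⟨z, hz⟩ := exists_tendsto_birkhoffMean ν (fun j => f j)
      (fun j => (f j).continuous.measurable)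
      (fun j => (f j).continuous.integrable_of_hasCompactSupport
        (HasCompactSupport.of_compactSpace _))
    intro y
    let w : ℕ → ℕ → X := fun m n => if n < m then y n else z n
    have hw : Tendsto w atTop (𝓝 y) := tendsto_pi_nhds.2 fun n =>
      tendsto_const_nhds.congr' ((eventually_gt_atTop n).mono fun m hm => (if_pos hm).symm)
    refine mem_closure_of_tendsto hw (.of_forall fun m => ?_)
    have hwz : w m =ᶠ[atTop] z := (eventually_ge_atTop m).mono fun n hn => if_neg hn.not_gt
    have hlim : Tendsto (e (w m)) atTop (𝓝 (Φ ν)) :=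
      tendsto_pi_nhds.2 fun j => tendsto_birkhoffMean_congr hwz (hz j)
    obtain ⟨N, hN, hNk⟩ :=
      ((hlim.eventually ((hB B).mem_nhds hνB)).and (eventually_ge_atTop k)).exists
    exact Set.mem_biUnion hNk hN
  obtain ⟨y, hy⟩ := (dense_iInter_of_isOpen hUo hUd).nonempty
  rw [Set.mem_iInter] at hy
  refine ⟨y, fun ν hν => ?_⟩
  have hcl : MapClusterPt (Φ ν) atTop (e y) := by
    have hbasis := TopologicalSpace.isBasis_countableBasis (ℕ → ℝ)
    rw [hbasis.nhds_hasBasis.mapClusterPt_iff_frequently]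
    rintro B ⟨hB, hBν⟩
    rw [frequently_atTop]
    intro k
    obtain ⟨N, hN, h⟩ := Set.mem_iUnion₂.1 (hy (⟨B, hB, ν, hν, hBν⟩, k))
    exact ⟨N, hN, h⟩
  obtain ⟨N, hN, hlim⟩ := hcl.tendsto_subseq
  exact ⟨N, hN, tendsto_birkhoffMean_of_denseRange ν hf (tendsto_pi_nhds.1 hlim)⟩

/-- A continuous bounded function tending to zero has time averages tending to zero. -/
theorem tendsto_mean_of_tendsto_zero {h : ℝ → ℝ} (hc : ContinuousOn h (Set.Ici 0)) {C : ℝ}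
    (hC : ∀ s, |h s| ≤ C) (h0 : Tendsto h atTop (𝓝 0)) :
    Tendsto (fun t : ℝ => (1 / t) * ∫ s in (0 : ℝ)..t, h s) atTop (𝓝 0) := by
  have hlim : Tendsto (fun t : ℝ => ∫ u in (0 : ℝ)..1, h (t * u)) atTop
      (𝓝 (∫ _ in (0 : ℝ)..1, (0 : ℝ))) := by
    refine intervalIntegral.tendsto_integral_filter_of_dominated_convergence (fun _ => C)
      ((eventually_ge_atTop 0).mono fun t ht => ?_) (.of_forall fun t => .of_forall fun u _ =>
        hC _) intervalIntegrable_const (.of_forall fun u hu => ?_)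
    · refine ContinuousOn.aestronglyMeasurable (hc.comp (by fun_prop) fun u hu => ?_)
        measurableSet_uIoc
      rw [Set.uIoc_of_le zero_le_one] at hu
      exact mul_nonneg ht hu.1.le
    · rw [Set.uIoc_of_le zero_le_one] at hu
      exact h0.comp (tendsto_id.atTop_mul_const hu.1)
  rw [intervalIntegral.integral_zero] at hlim
  refine hlim.congr' ((eventually_gt_atTop 0).mono fun t ht => ?_)
  simp [intervalIntegral.integral_comp_mul_left h ht.ne']

theorem isPathConnected_thickening {E : Type*} [NormedAddCommGroup E] [NormedSpace ℝ E] {K : Set E}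
    (hK : IsConnected K) {δ : ℝ} (hδ : 0 < δ) : IsPathConnected (Metric.thickening δ K) := by
  rw [← Metric.isOpen_thickening.isConnected_iff_isPathConnected, ← add_ball_zero,
    ← Set.add_image_prod]
  exact (hK.prod ((convex_ball (0 : E) δ).isConnected (Metric.nonempty_ball.2 hδ))).image _
    continuous_add.continuousOn

/-- The curve following `p n` during `[n + 1 - 1 / (n + 1), n + 1]`, at rest otherwise. -/
noncomputable def restCurve {E : Type*} [TopologicalSpace E] {y : ℕ → E}
    (p : ∀ n, Path (y n) (y (n + 1))) (s : ℝ) : E :=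
  (p ⌊s⌋₊).extend (1 + (⌊s⌋₊ + 1) * (s - (⌊s⌋₊ + 1)))

theorem restCurve_eq {E : Type*} [TopologicalSpace E] {y : ℕ → E}
    (p : ∀ n, Path (y n) (y (n + 1))) {n : ℕ} {s : ℝ} (hs : s ∈ Set.Icc (n : ℝ) (n + 1)) :
    restCurve p s = (p n).extend (1 + (n + 1) * (s - (n + 1))) := by
  rcases hs.2.eq_or_lt with rfl | h
  · have hf : ⌊(n : ℝ) + 1⌋₊ = n + 1 := by exact_mod_cast Nat.floor_natCast (R := ℝ) (n + 1)
    rw [restCurve, hf, Path.extend_of_le_zero, sub_self, mul_zero, add_zero, Path.extend_one]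
    push_cast
    nlinarith [Nat.cast_nonneg (α := ℝ) n]
  · have hf : ⌊s⌋₊ = n := (Nat.floor_eq_iff (n.cast_nonneg.trans hs.1)).2 ⟨hs.1, h⟩
    rw [restCurve, hf]

theorem restCurve_eq_of_le {E : Type*} [TopologicalSpace E] {y : ℕ → E}
    (p : ∀ n, Path (y n) (y (n + 1))) {n : ℕ} {s : ℝ}
    (hs : s ∈ Set.Icc (n : ℝ) (n + 1 - (n + 1 : ℝ)⁻¹)) : restCurve p s = y n := by
  have hn : (0 : ℝ) < n + 1 := by positivity
  rw [restCurve_eq p ⟨hs.1, hs.2.trans (by simpa using hn.le)⟩, Path.extend_of_le_zero]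
  have := mul_le_mul_of_nonneg_left hs.2 hn.le
  rw [mul_sub, mul_inv_cancel₀ hn.ne'] at this
  linarith

theorem continuousOn_restCurve {E : Type*} [TopologicalSpace E] {y : ℕ → E}
    (p : ∀ n, Path (y n) (y (n + 1))) : ContinuousOn (restCurve p) (Set.Ici 0) := by
  have hstep : ∀ n : ℕ, ContinuousOn (restCurve p) (Set.Icc (n : ℝ) (n + 1)) := fun n =>
    ((p n).continuous_extend.comp (by fun_prop :
      Continuous fun s : ℝ => 1 + ((n : ℝ) + 1) * (s - (n + 1)))).continuousOn.congr
        fun s hs => restCurve_eq p hs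
  have hIcc : ∀ n : ℕ, ContinuousOn (restCurve p) (Set.Icc (0 : ℝ) n) := by
    intro n
    induction n with
    | zero => simp
    | succ n ih =>
      rw [Nat.cast_succ, ← Set.Icc_union_Icc_eq_Icc n.cast_nonneg (by linarith :
        (n : ℝ) ≤ n + 1)]
      exact ih.union_of_isClosed (hstep n) isClosed_Icc isClosed_Icc
  intro s hs
  obtain ⟨n, hn⟩ := exists_nat_gt s
  refine (hIcc n s ⟨hs, hn.le⟩).mono_of_mem_nhdsWithin ?_
  filter_upwards [self_mem_nhdsWithin, mem_nhdsWithin_of_mem_nhds (Iio_mem_nhds hn)] with t h0 h1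
  exact ⟨h0, le_of_lt h1⟩

theorem intervalIntegrable_comp_restCurve {E : Type*} [TopologicalSpace E] {y : ℕ → E}
    (p : ∀ n, Path (y n) (y (n + 1))) {F : E → ℝ} (hF : Continuous F) {a b : ℝ} (ha : 0 ≤ a)
    (hb : 0 ≤ b) : IntervalIntegrable (fun s => F (restCurve p s)) volume a b :=
  ((hF.comp_continuousOn (continuousOn_restCurve p)).mono fun _ hs =>
    (le_min ha hb).trans hs.1).intervalIntegrable

theorem abs_integral_restCurve_sub_le {E : Type*} [TopologicalSpace E] {y : ℕ → E}
    (p : ∀ n, Path (y n) (y (n + 1))) {F : E → ℝ} (hF : Continuous F) {C : ℝ}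
    (hC : ∀ x, |F x| ≤ C) (n : ℕ) :
    |(∫ s in (n : ℝ)..(n + 1 : ℕ), F (restCurve p s)) - F (y n)| ≤ 2 * C * (n + 1 : ℝ)⁻¹ := by
  have hn : (0 : ℝ) ≤ n := n.cast_nonneg
  have hinv : (n + 1 : ℝ)⁻¹ ≤ 1 := inv_le_one_of_one_le₀ (by linarith)
  have hinv0 : 0 ≤ (n + 1 : ℝ)⁻¹ := by positivity
  set c : ℝ := n + 1 - (n + 1 : ℝ)⁻¹ with hc
  have hnc : (n : ℝ) ≤ c := by linarith
  have hcn : c ≤ (n + 1 : ℕ) := by push_cast; linarith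
  rw [← intervalIntegral.integral_add_adjacent_intervals (b := c)
    (intervalIntegrable_comp_restCurve p hF hn (hn.trans hnc))
    (intervalIntegrable_comp_restCurve p hF (hn.trans hnc) (by positivity))]
  have h1 : ∫ s in (n : ℝ)..c, F (restCurve p s) = (c - n) * F (y n) := by
    rw [intervalIntegral.integral_congr (g := fun _ => F (y n)), intervalIntegral.integral_const,
      smul_eq_mul]
    intro s hs
    rw [Set.uIcc_of_le hnc] at hs
    simp only [restCurve_eq_of_le p hs]
  have h2 := intervalIntegral.norm_integral_le_of_norm_le_const (a := c) (b := (n + 1 : ℕ))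
    (f := fun s => F (restCurve p s)) (C := C) fun s _ => hC _
  have e1 : ((n + 1 : ℕ) : ℝ) - c = (n + 1 : ℝ)⁻¹ := by push_cast; rw [hc]; ring
  have e2 : (c - n) = 1 - (n + 1 : ℝ)⁻¹ := by rw [hc]; ring
  rw [e1, abs_of_nonneg hinv0, Real.norm_eq_abs] at h2
  rw [h1, e2]
  have h3 : |(n + 1 : ℝ)⁻¹ * F (y n)| ≤ (n + 1 : ℝ)⁻¹ * C := by
    rw [abs_mul, abs_of_nonneg hinv0]
    exact mul_le_mul_of_nonneg_left (hC _) hinv0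
  rw [abs_le] at h2 h3 ⊢
  constructor <;> linarith [h2.1, h2.2, h3.1, h3.2]

theorem tendsto_integral_restCurve_sub_birkhoffMean {E : Type*} [TopologicalSpace E] {y : ℕ → E}
    (p : ∀ n, Path (y n) (y (n + 1))) {F : E → ℝ} (hF : Continuous F) {C : ℝ}
    (hC : ∀ x, |F x| ≤ C) :
    Tendsto (fun N : ℕ => (N : ℝ)⁻¹ * (∫ s in (0 : ℝ)..N, F (restCurve p s)) - birkhoffMean y F N)
      atTop (𝓝 0) := by
  have h0 : Tendsto (fun n : ℕ => (∫ s in (n : ℝ)..(n + 1 : ℕ), F (restCurve p s)) - F (y n))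
      atTop (𝓝 0) := by
    refine squeeze_zero_norm (abs_integral_restCurve_sub_le p hF hC) ?_
    simpa using (tendsto_one_div_add_atTop_nhds_zero_nat (𝕜 := ℝ)).const_mul (2 * C)
  refine h0.cesaro.congr fun N => ?_
  have := intervalIntegral.sum_integral_adjacent_intervals (μ := volume)
    (f := fun s => F (restCurve p s)) (a := fun n : ℕ => (n : ℝ)) (n := N) fun k _ =>
      intervalIntegrable_comp_restCurve p hF k.cast_nonneg (Nat.cast_nonneg _)
  rw [Finset.sum_sub_distrib, this, birkhoffMean, mul_sub, Nat.cast_zero]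

theorem exists_restCurve_mem_thickening {E : Type*} [NormedAddCommGroup E] [NormedSpace ℝ E]
    {K : Set E} (hK : IsConnected K) {y : ℕ → E} (hy : ∀ n, y n ∈ K) :
    ∃ p : ∀ n, Path (y n) (y (n + 1)), ∀ s,
      restCurve p s ∈ Metric.thickening (1 / (⌊s⌋₊ + 1)) K := by
  have h : ∀ n : ℕ, JoinedIn (Metric.thickening (1 / (n + 1 : ℝ)) K) (y n) (y (n + 1)) := fun n =>
    have hn : (0 : ℝ) < 1 / (n + 1) := by positivity
    (isPathConnected_thickening hK hn).joinedIn _ (Metric.self_subset_thickening hn _ (hy n)) _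
      (Metric.self_subset_thickening hn _ (hy (n + 1)))
  choose p hp using h
  refine ⟨p, fun s => ?_⟩
  have hr := Set.mem_range_self (f := (p ⌊s⌋₊).extend) (1 + (⌊s⌋₊ + 1) * (s - (⌊s⌋₊ + 1)))
  rw [Path.extend_range] at hr
  obtain ⟨t, ht⟩ := hr
  rw [restCurve, ← ht]
  exact hp _ t

/-- The Cesàro limit measures of a curve approaching a closed set `K` are carried by `K`. -/
theorem measure_eq_one_of_mem_cesaroLimits {d : ℕ} {γ : ℝ → EuclideanSpace ℝ (Fin d)}
    {K : Set (EuclideanSpace ℝ (Fin d))} (hne : K.Nonempty) (hK : IsClosed K)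
    (hγ : ContinuousOn γ (Set.Ici 0)) (hlim : Tendsto (fun s => Metric.infDist (γ s) K) atTop (𝓝 0))
    {μ : ProbabilityMeasure (EuclideanSpace ℝ (Fin d))} (hμ : μ ∈ cesaroLimits γ) :
    (μ : Measure (EuclideanSpace ℝ (Fin d))) K = 1 := by
  obtain ⟨T, hT, h⟩ := hμ
  let F : EuclideanSpace ℝ (Fin d) → ℝ := fun x => min 1 (Metric.infDist x K)
  have hF : Continuous F := continuous_const.min (Metric.continuous_infDist_pt K)
  have hF0 : ∀ x, 0 ≤ F x := fun x => le_min zero_le_one Metric.infDist_nonneg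
  have hF1 : ∀ x, |F x| ≤ 1 := fun x => by rw [abs_of_nonneg (hF0 x)]; exact min_le_left _ _
  have h0 : Tendsto (fun s => F (γ s)) atTop (𝓝 0) := by
    simpa [F] using (tendsto_const_nhds (x := (1 : ℝ))).min hlim
  have hmean : Tendsto (fun t : ℝ => (1 / t) * ∫ s in (0 : ℝ)..t, F (γ s)) atTop (𝓝 0) :=
    tendsto_mean_of_tendsto_zero (hF.comp_continuousOn hγ) (fun s => hF1 (γ s)) h0
  have hint : ∫ x, F x ∂(μ : Measure (EuclideanSpace ℝ (Fin d))) = 0 :=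
    tendsto_nhds_unique (h F hF ⟨1, hF1⟩) (hmean.comp hT)
  have hFi : Integrable F (μ : Measure (EuclideanSpace ℝ (Fin d))) :=
    .of_bound hF.aestronglyMeasurable 1 (.of_forall hF1)
  rw [integral_eq_zero_iff_of_nonneg hF0 hFi] at hint
  rw [← mem_ae_iff_prob_eq_one hK.measurableSet]
  filter_upwards [hint] with x hx
  rw [hK.mem_iff_infDist_zero hne]
  by_contra hne'
  have : 0 < F x := lt_min one_pos (lt_of_le_of_ne Metric.infDist_nonneg (Ne.symm hne'))
  exact this.ne hx.symm

/-- For a nonempty compact connected `K ⊆ ℝ^d` there is a single bounded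
continuous curve `γ_un : [0,∞) → ℝ^d` with `dist(γ_un(s),K) → 0` as `s → ∞`
such that `M(γ_un)` equals the whole set `P(K)` of Borel probability measures
giving full mass to `K`. -/
theorem stmt_9 (d : ℕ) (hd : 1 ≤ d) (K : Set (EuclideanSpace ℝ (Fin d)))
    (hKne : K.Nonempty) (hKc : IsCompact K) (hKconn : IsConnected K) :
    ∃ γ : ℝ → EuclideanSpace ℝ (Fin d),
      ContinuousOn γ (Set.Ici 0) ∧
      (∃ C, ∀ s ∈ Set.Ici (0 : ℝ), ‖γ s‖ ≤ C) ∧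
      Tendsto (fun s => Metric.infDist (γ s) K) atTop (𝓝 0) ∧
      cesaroLimits γ
        = {μ : ProbabilityMeasure (EuclideanSpace ℝ (Fin d)) |
            (μ : Measure (EuclideanSpace ℝ (Fin d))) K = 1} := by
  have : CompactSpace K := isCompact_iff_compactSpace.1 hKc
  have : Nonempty K := hKne.to_subtype
  obtain ⟨y, hy⟩ := exists_universal_seq K
  obtain ⟨p, hp⟩ := exists_restCurve_mem_thickening hKconn (y := fun n => (y n : _))
    fun n => (y n).2
  have hcont := continuousOn_restCurve p
  have hlim : Tendsto (fun s => Metric.infDist (restCurve p s) K) atTop (𝓝 0) := by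
    refine squeeze_zero' (.of_forall fun s => Metric.infDist_nonneg)
      (.of_forall fun s => ?_)
      ((tendsto_one_div_add_atTop_nhds_zero_nat (𝕜 := ℝ)).comp (tendsto_nat_floor_atTop (α := ℝ)))
    exact ((Metric.mem_thickening_iff_infDist_lt hKne).1 (hp s)).le
  refine ⟨restCurve p, hcont, ?_, hlim, Set.Subset.antisymm (fun μ hμ =>
    measure_eq_one_of_mem_cesaroLimits hKne hKc.isClosed hcont hlim hμ) fun μ hμ => ?_⟩
  · obtain ⟨C, hC⟩ := (hKc.isBounded.thickening (δ := 1)).exists_norm_le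
    refine ⟨C, fun s _ => hC _ (Metric.thickening_mono ?_ _ (hp s))⟩
    rw [one_div]
    exact inv_le_one_of_one_le₀ (by linarith [Nat.cast_nonneg (α := ℝ) ⌊s⌋₊])
  · have hemb := MeasurableEmbedding.subtype_coe hKc.measurableSet
    let ν : Measure K := (μ : Measure _).comap Subtype.val
    have hν : IsProbabilityMeasure ν := ⟨by
      rw [hemb.comap_apply, Set.image_univ, Subtype.range_coe]
      exact hμ⟩
    obtain ⟨N, hN, h⟩ := hy ν hν
    refine ⟨fun k => N k, tendsto_natCast_atTop_atTop.comp hN.tendsto_atTop,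
      fun F hF ⟨C, hC⟩ => ?_⟩
    have hint : ∫ x, F x ∂(μ : Measure _) = ∫ x : K, F x ∂ν := by
      rw [integral_subtype_comap hKc.measurableSet, Measure.restrict_eq_self_of_ae_mem]
      exact (mem_ae_iff_prob_eq_one hKc.measurableSet).2 hμ
    have h1 := (tendsto_integral_restCurve_sub_birkhoffMean p hF hC).comp hN.tendsto_atTop
    have h2 := h1.add (h ⟨fun x => F x, hF.comp continuous_subtype_val⟩)
    rw [hint]
    simpa [birkhoffMean] using h2
end
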